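/- Every simple root assigned to an arrow of H(Φ_long^+) is long; that is, if β and β + α_i are both long positive roots of Φ with α_i simple, then α_i is a long root. -/

import Mathlib

noncomputable section

namespace Paper

/-- The root lattice of rank `l`, with coordinates taken in the basis of simple roots. -/
abbrev RL (l : ℕ) := Fin l → ℤ

/-- The `i`-th simple root `αᵢ`. -/
def sroot (l : ℕ) (i : Fin l) : RL l := Pi.single i 1

/-- The Cartan pairing `⟨v, αᵢ^∨⟩` attached to a Cartan matrix `A`,
with the convention `A i j = ⟨αⱼ, αᵢ^∨⟩`. -/
def cmPair (l : ℕ) (A : Matrix (Fin l) (Fin l) ℤ) (v : RL l) (i : Fin l) : ℤ :=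
  ∑ j, A i j * v j

/-- The closure of a set `S0` of root-lattice vectors under all simple reflections
(computed with respect to the Cartan matrix `A`). -/
def orbitOf (l : ℕ) (A : Matrix (Fin l) (Fin l) ℤ) (S0 : Set (RL l)) : Set (RL l) :=
  ⋂₀ {T | S0 ⊆ T ∧ ∀ v ∈ T, ∀ i : Fin l, v - cmPair l A v i • sroot l i ∈ T}

/-- The set `Φ` of roots of the root system with Cartan matrix `A`:
the orbit of the simple roots under the Weyl group. -/
def rootsOf (l : ℕ) (A : Matrix (Fin l) (Fin l) ℤ) : Set (RL l) :=
  orbitOf l A {v | ∃ i, v = sroot l i}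

/-- The set `Φ⁺` of positive roots. -/
def posRoots (l : ℕ) (A : Matrix (Fin l) (Fin l) ℤ) : Set (RL l) :=
  {v ∈ rootsOf l A | ∀ i, 0 ≤ v i}

/-- The (suitably scaled) squared length `⟨v, v⟩` with respect to the symmetrizer `d`
(`d i` represents half the squared length of `αᵢ`). -/
def nsq (l : ℕ) (A : Matrix (Fin l) (Fin l) ℤ) (d : Fin l → ℤ) (v : RL l) : ℤ :=
  ∑ i, ∑ j, d i * A i j * v i * v j

/-- The set of roots of squared length `c`. -/
def lenSet (l : ℕ) (A : Matrix (Fin l) (Fin l) ℤ) (d : Fin l → ℤ) (c : ℤ) : Set (RL l) :=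
  {v ∈ rootsOf l A | nsq l A d v = c}

/-- The set of positive roots of squared length `c`. -/
def posLen (l : ℕ) (A : Matrix (Fin l) (Fin l) ℤ) (d : Fin l → ℤ) (c : ℤ) : Set (RL l) :=
  {v ∈ lenSet l A d c | ∀ i, 0 ≤ v i}

/-! Cartan matrices (Bourbaki numbering, shifted to be 0-indexed);
the convention is `A i j = ⟨αⱼ, αᵢ^∨⟩`. -/

/-- The Cartan matrix of type `A_l`. -/
def CM_A (l : ℕ) : Matrix (Fin l) (Fin l) ℤ := Matrix.of fun i j =>
  if i = j then 2 else if (i : ℕ) + 1 = (j : ℕ) ∨ (j : ℕ) + 1 = (i : ℕ) then -1 else 0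

/-- The Cartan matrix of type `B_l` (the last simple root is short). -/
def CM_B (l : ℕ) : Matrix (Fin l) (Fin l) ℤ := Matrix.of fun i j =>
  if i = j then 2
  else if (i : ℕ) = (j : ℕ) + 1 then (if (i : ℕ) = l - 1 then -2 else -1)
  else if (j : ℕ) = (i : ℕ) + 1 then -1 else 0

/-- The Cartan matrix of type `C_l` (the last simple root is long). -/
def CM_C (l : ℕ) : Matrix (Fin l) (Fin l) ℤ := Matrix.of fun i j =>
  if i = j then 2
  else if (j : ℕ) = (i : ℕ) + 1 then (if (j : ℕ) = l - 1 then -2 else -1)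
  else if (i : ℕ) = (j : ℕ) + 1 then -1 else 0

/-- The Cartan matrix of type `D_l`. -/
def CM_D (l : ℕ) : Matrix (Fin l) (Fin l) ℤ := Matrix.of fun i j =>
  if i = j then 2
  else if ((i : ℕ) + 1 = (j : ℕ) ∧ (j : ℕ) + 1 ≤ l - 1) ∨
          ((j : ℕ) + 1 = (i : ℕ) ∧ (i : ℕ) + 1 ≤ l - 1) ∨
          ((i : ℕ) = l - 3 ∧ (j : ℕ) = l - 1) ∨ ((j : ℕ) = l - 3 ∧ (i : ℕ) = l - 1) then -1
  else 0

/-- The Cartan matrix of type `E_l` (`l ∈ {6,7,8}`). -/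
def CM_E (l : ℕ) : Matrix (Fin l) (Fin l) ℤ := Matrix.of fun i j =>
  if i = j then 2
  else if ((i : ℕ) = 0 ∧ (j : ℕ) = 2) ∨ ((j : ℕ) = 0 ∧ (i : ℕ) = 2) ∨
          ((i : ℕ) = 1 ∧ (j : ℕ) = 3) ∨ ((j : ℕ) = 1 ∧ (i : ℕ) = 3) ∨
          (2 ≤ (i : ℕ) ∧ (j : ℕ) = (i : ℕ) + 1) ∨
          (2 ≤ (j : ℕ) ∧ (i : ℕ) = (j : ℕ) + 1) then -1
  else 0

/-- The Cartan matrix of type `F₄` (used with `l = 4`; `α₁, α₂` long, `α₃, α₄` short). -/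
def CM_F4 (l : ℕ) : Matrix (Fin l) (Fin l) ℤ := Matrix.of fun i j =>
  if i = j then 2
  else if ((i : ℕ) = 0 ∧ (j : ℕ) = 1) ∨ ((j : ℕ) = 0 ∧ (i : ℕ) = 1) ∨
          ((i : ℕ) = 1 ∧ (j : ℕ) = 2) ∨
          ((i : ℕ) = 2 ∧ (j : ℕ) = 3) ∨ ((j : ℕ) = 2 ∧ (i : ℕ) = 3) then -1
  else if (i : ℕ) = 2 ∧ (j : ℕ) = 1 then -2 else 0

/-- The Cartan matrix of type `G₂` (used with `l = 2`; `α₁` short, `α₂` long). -/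
def CM_G2 (l : ℕ) : Matrix (Fin l) (Fin l) ℤ := Matrix.of fun i j =>
  if i = j then 2
  else if (i : ℕ) = 0 ∧ (j : ℕ) = 1 then -3
  else if (i : ℕ) = 1 ∧ (j : ℕ) = 0 then -1 else 0

/-! Symmetrizers: `d i` is half the squared length of `αᵢ`, scaled so that short
roots have squared length `2` and long roots have squared length `4` (resp. `6` in
type `G₂`). -/

/-- Symmetrizer for type `B_l`. -/
def dB (l : ℕ) : Fin l → ℤ := fun i => if (i : ℕ) = l - 1 then 1 else 2
/-- Symmetrizer for type `C_l`. -/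
def dC (l : ℕ) : Fin l → ℤ := fun i => if (i : ℕ) = l - 1 then 2 else 1
/-- Symmetrizer for type `F₄`. -/
def dF4 (l : ℕ) : Fin l → ℤ := fun i => if (i : ℕ) ≤ 1 then 2 else 1
/-- Symmetrizer for type `G₂`. -/
def dG2 (l : ℕ) : Fin l → ℤ := fun i => if (i : ℕ) = 0 then 1 else 3

/-- Adjacency in (the underlying undirected graph of) the Hasse diagram of a set `P`
of positive roots: two vertices of `P` are joined iff they differ by a simple root. -/
def hstep (l : ℕ) (P : Set (RL l)) (v w : RL l) : Prop :=
  v ∈ P ∧ w ∈ P ∧ ∃ i : Fin l, w = v + sroot l i ∨ v = w + sroot l i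

/-- Connectivity (reachability) in the Hasse diagram of `P`. -/
def hconn (l : ℕ) (P : Set (RL l)) : RL l → RL l → Prop :=
  Relation.ReflTransGen (hstep l P)

/-- The connected component `𝒞₀` of the Hasse diagram `H(Φ_long⁺)` of long positive
roots which contains the long simple roots (long = squared length `4` here; this is
used for types `B`, `C`, `F₄`). -/
def C0 (l : ℕ) (A : Matrix (Fin l) (Fin l) ℤ) (d : Fin l → ℤ) : Set (RL l) :=
  {v | ∃ i : Fin l, sroot l i ∈ lenSet l A d 4 ∧ hconn l (posLen l A d 4) (sroot l i) v}

theorem sroot_mem_rootsOf (l : ℕ) (A : Matrix (Fin l) (Fin l) ℤ) (i : Fin l) :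
    sroot l i ∈ rootsOf l A :=
  Set.mem_sInter.2 fun _ hT => hT.1 ⟨i, rfl⟩

theorem cmPair_add_smul_sroot (l : ℕ) (A : Matrix (Fin l) (Fin l) ℤ) (v : RL l) (c : ℤ)
    (i k : Fin l) : cmPair l A (v + c • sroot l i) k = cmPair l A v k + c * A k i := by
  simp [cmPair, sroot, mul_add, Finset.sum_add_distrib, Pi.single_apply, mul_comm]

theorem nsq_eq_sum_cmPair (l : ℕ) (A : Matrix (Fin l) (Fin l) ℤ) (d : Fin l → ℤ) (v : RL l) :
    nsq l A d v = ∑ k, d k * v k * cmPair l A v k := by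
  simp only [nsq, cmPair, Finset.mul_sum]
  exact Finset.sum_congr rfl fun _ _ => Finset.sum_congr rfl fun _ _ => by ring

theorem mul_cmPair_eq_sum {l : ℕ} {A : Matrix (Fin l) (Fin l) ℤ} {d : Fin l → ℤ}
    (hsymm : ∀ i j, d i * A i j = d j * A j i) (v : RL l) (i : Fin l) :
    d i * cmPair l A v i = ∑ k, d k * v k * A k i := by
  simp only [cmPair, Finset.mul_sum]
  refine Finset.sum_congr rfl fun k _ => ?_
  linear_combination v k * hsymm i k

theorem nsq_add_smul_sroot {l : ℕ} {A : Matrix (Fin l) (Fin l) ℤ} {d : Fin l → ℤ}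
    (hdiag : ∀ i, A i i = 2) (hsymm : ∀ i j, d i * A i j = d j * A j i)
    (v : RL l) (c : ℤ) (i : Fin l) :
    nsq l A d (v + c • sroot l i) =
      nsq l A d v + 2 * c * (d i * cmPair l A v i) + 2 * c ^ 2 * d i := by
  have hterm : ∀ k, d k * (v + c • sroot l i) k * cmPair l A (v + c • sroot l i) k =
      d k * v k * cmPair l A v k + c * (d k * v k * A k i) +
        (if k = i then c * (d i * cmPair l A v i) + 2 * c ^ 2 * d i else 0) := by
    intro k
    rw [cmPair_add_smul_sroot]
    by_cases hk : k = i
    · subst hk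
      simp only [Pi.add_apply, Pi.smul_apply, sroot, Pi.single_eq_same, smul_eq_mul, hdiag,
        if_true]
      ring
    · simp only [Pi.add_apply, Pi.smul_apply, sroot, Pi.single_eq_of_ne hk, smul_eq_mul, hk,
        if_false]
      ring
  rw [nsq_eq_sum_cmPair, nsq_eq_sum_cmPair, Finset.sum_congr rfl fun k _ => hterm k,
    Finset.sum_add_distrib, Finset.sum_add_distrib, ← Finset.mul_sum,
    ← mul_cmPair_eq_sum hsymm, Finset.sum_ite_eq' Finset.univ i, if_pos (Finset.mem_univ i)]
  ring

theorem nsq_sroot {l : ℕ} {A : Matrix (Fin l) (Fin l) ℤ} {d : Fin l → ℤ}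
    (hdiag : ∀ i, A i i = 2) (hsymm : ∀ i j, d i * A i j = d j * A j i) (i : Fin l) :
    nsq l A d (sroot l i) = 2 * d i := by
  simpa [nsq, cmPair] using nsq_add_smul_sroot hdiag hsymm 0 1 i

theorem dvd_mul_cmPair {l : ℕ} {A : Matrix (Fin l) (Fin l) ℤ} {d : Fin l → ℤ}
    (hsymm : ∀ i j, d i * A i j = d j * A j i) {D : ℤ} {v : RL l} (hv : ∀ j, D ∣ d j * v j)
    (i : Fin l) : D ∣ d i * cmPair l A v i := by
  rw [mul_cmPair_eq_sum hsymm]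
  exact Finset.dvd_sum fun k _ => (hv k).mul_right _

/-- A root of squared length `2 * D` has coroot with integral coordinates `d j * v j / D`. -/
theorem dvd_coeff_of_mem_rootsOf {l : ℕ} {A : Matrix (Fin l) (Fin l) ℤ} {d : Fin l → ℤ}
    (hdiag : ∀ i, A i i = 2) (hsymm : ∀ i j, d i * A i j = d j * A j i) {D : ℤ} {v : RL l}
    (hv : v ∈ rootsOf l A) (hlen : nsq l A d v = 2 * D) (j : Fin l) : D ∣ d j * v j := by
  refine Set.mem_sInter.1 hv {w | nsq l A d w = 2 * D → ∀ j, D ∣ d j * w j} ⟨?_, ?_⟩ hlen j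
  · rintro _ ⟨k, rfl⟩ hk j
    rw [nsq_sroot hdiag hsymm] at hk
    obtain rfl : d k = D := by linarith
    by_cases hj : j = k
    · subst hj
      exact dvd_mul_right _ _
    · simp [sroot, hj]
  · intro w hw i hlen' j
    rw [sub_eq_add_neg, ← neg_smul] at hlen' ⊢
    rw [nsq_add_smul_sroot hdiag hsymm] at hlen'
    have hdvd := hw (by linear_combination hlen')
    have hpair := dvd_mul_cmPair hsymm hdvd i
    by_cases hj : j = i
    · subst hj
      simpa [sroot, mul_add, sub_eq_add_neg] using (hdvd j).sub hpair
    · simpa [sroot, hj] using hdvd j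

/-- If every `d i` is `1` or `D` with `D` at least `2`, then a simple root which is the
difference of two roots of squared length `2 * D` has squared length `2 * D` itself. -/
theorem sroot_mem_lenSet_of_add_mem {l : ℕ} {A : Matrix (Fin l) (Fin l) ℤ} {d : Fin l → ℤ}
    (hdiag : ∀ i, A i i = 2) (hsymm : ∀ i j, d i * A i j = d j * A j i) {D : ℤ} (hD : 2 ≤ D)
    (hd : ∀ i, d i = 1 ∨ d i = D) {β : RL l} (hβ : β ∈ lenSet l A d (2 * D)) {i : Fin l}
    (hβi : β + sroot l i ∈ lenSet l A d (2 * D)) : sroot l i ∈ lenSet l A d (2 * D) := by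
  refine ⟨sroot_mem_rootsOf l A i, ?_⟩
  rw [nsq_sroot hdiag hsymm]
  rcases hd i with hi | hi
  · have hpair := dvd_mul_cmPair hsymm (dvd_coeff_of_mem_rootsOf hdiag hsymm hβ.1 hβ.2) i
    have hlen := nsq_add_smul_sroot hdiag hsymm β 1 i
    rw [one_smul, hβi.2, hβ.2] at hlen
    have hneg : d i * cmPair l A β i = -1 := by linarith
    rw [hneg, dvd_neg] at hpair
    linarith [Int.le_of_dvd one_pos hpair]
  · rw [hi]

theorem CM_B_symmetrizable (l : ℕ) (i j : Fin l) :
    dB l i * CM_B l i j = dB l j * CM_B l j i := by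
  simp only [dB, CM_B, Matrix.of_apply, Fin.ext_iff]
  split_ifs <;> omega

theorem CM_C_symmetrizable (l : ℕ) (i j : Fin l) :
    dC l i * CM_C l i j = dC l j * CM_C l j i := by
  simp only [dC, CM_C, Matrix.of_apply, Fin.ext_iff]
  split_ifs <;> omega

theorem CM_F4_symmetrizable (l : ℕ) (i j : Fin l) :
    dF4 l i * CM_F4 l i j = dF4 l j * CM_F4 l j i := by
  simp only [dF4, CM_F4, Matrix.of_apply, Fin.ext_iff]
  split_ifs <;> omega

theorem CM_G2_symmetrizable (i j : Fin 2) :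
    dG2 2 i * CM_G2 2 i j = dG2 2 j * CM_G2 2 j i := by
  fin_cases i <;> fin_cases j <;> simp [dG2, CM_G2]

/-- In types `B_l (l ≥ 2)`, `C_l (l ≥ 2)`, `F₄` and `G₂`: if `β` and
`β + αᵢ` are both long positive roots (with `αᵢ` simple), then `αᵢ` is long; i.e. every
simple root assigned to an arrow of `H(Φ_long⁺)` is long. -/
theorem arrows_of_long_hasse_are_long :
    (∀ l : ℕ, 2 ≤ l → ∀ β ∈ posLen l (CM_B l) (dB l) 4, ∀ i : Fin l,
      β + sroot l i ∈ posLen l (CM_B l) (dB l) 4 → sroot l i ∈ lenSet l (CM_B l) (dB l) 4) ∧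
    (∀ l : ℕ, 2 ≤ l → ∀ β ∈ posLen l (CM_C l) (dC l) 4, ∀ i : Fin l,
      β + sroot l i ∈ posLen l (CM_C l) (dC l) 4 → sroot l i ∈ lenSet l (CM_C l) (dC l) 4) ∧
    (∀ β ∈ posLen 4 (CM_F4 4) (dF4 4) 4, ∀ i : Fin 4,
      β + sroot 4 i ∈ posLen 4 (CM_F4 4) (dF4 4) 4 → sroot 4 i ∈ lenSet 4 (CM_F4 4) (dF4 4) 4) ∧
    (∀ β ∈ posLen 2 (CM_G2 2) (dG2 2) 6, ∀ i : Fin 2,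
      β + sroot 2 i ∈ posLen 2 (CM_G2 2) (dG2 2) 6 → sroot 2 i ∈ lenSet 2 (CM_G2 2) (dG2 2) 6) := by
  refine ⟨fun l _ β hβ i hβi => ?_, fun l _ β hβ i hβi => ?_, fun β hβ i hβi => ?_,
    fun β hβ i hβi => ?_⟩
  · exact sroot_mem_lenSet_of_add_mem (D := 2) (fun _ => by simp [CM_B])
      (CM_B_symmetrizable l) le_rfl (fun _ => by unfold dB; split_ifs <;> simp) hβ.1 hβi.1
  · exact sroot_mem_lenSet_of_add_mem (D := 2) (fun _ => by simp [CM_C])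
      (CM_C_symmetrizable l) le_rfl (fun _ => by unfold dC; split_ifs <;> simp) hβ.1 hβi.1
  · exact sroot_mem_lenSet_of_add_mem (D := 2) (fun _ => by simp [CM_F4])
      (CM_F4_symmetrizable 4) le_rfl (fun _ => by unfold dF4; split_ifs <;> simp) hβ.1 hβi.1
  · exact sroot_mem_lenSet_of_add_mem (D := 3) (fun _ => by simp [CM_G2])
      CM_G2_symmetrizable (by norm_num) (fun _ => by unfold dG2; split_ifs <;> simp) hβ.1 hβi.1

end Paper

end
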